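/- For each θ ∈ 𝔽₄ with θ² + θ + 1 = 0, the cubic surface S₃(θ) has exactly nine 𝔽₄-rational points: the number of points [v] of ℙ³(𝔽₄) with f₃(v) = 0 equals 9 (equivalently, the number of nonzero vectors v ∈ 𝔽₄⁴ with f₃(v) = 0 equals 27). -/

import Mathlib

open MvPolynomial

/-- The cubic form `X³ + Y³ + Z³ + θW³` with the variables `X, Y, Z, W` indexed by
`0, 1, 2, 3`, over any commutative ring `K` containing the coefficient `θ`. -/
noncomputable def f₃ (K : Type*) [CommRing K] (θ : K) : MvPolynomial (Fin 4) K :=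
  X 0 ^ 3 + X 1 ^ 3 + X 2 ^ 3 + C θ * X 3 ^ 3

/-- The nonzero zeros of a function on a vector space that is invariant up to nonzero scalars are
counted by `|Kˣ|` times the number of projective zeros. -/
theorem ncard_cone_eq_ncard_projective_mul {K V : Type*} [Field K] [AddCommGroup V] [Module K V]
    (P : V → Prop) (hP : ∀ (u : Kˣ) (v : V), P (u • v) ↔ P v) :
    {v : V | v ≠ 0 ∧ P v}.ncard =
      {x : Projectivization K V | P x.rep}.ncard * Nat.card Kˣ := by
  have hinj : Function.Injective
      (fun p : Projectivization K V × Kˣ => p.2 • p.1.rep) := by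
    rintro ⟨x, u⟩ ⟨y, w⟩ h
    simp only at h
    have hxy : x = y := by
      rw [← x.mk_rep, ← y.mk_rep, Projectivization.mk_eq_mk_iff]
      exact ⟨u⁻¹ * w, by rw [mul_smul, ← h, inv_smul_smul]⟩
    subst hxy
    have huw : u = w := Units.ext (smul_left_injective K x.rep_nonzero h)
    rw [huw]
  have himage : {v : V | v ≠ 0 ∧ P v} =
      (fun p : Projectivization K V × Kˣ => p.2 • p.1.rep) ''
        ({x : Projectivization K V | P x.rep} ×ˢ Set.univ) := by
    ext v
    constructor
    · rintro ⟨hv, hPv⟩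
      obtain ⟨u, hu⟩ := Projectivization.exists_smul_eq_mk_rep K v hv
      refine ⟨(Projectivization.mk K v hv, u⁻¹), ⟨?_, trivial⟩, ?_⟩
      · rw [Set.mem_ofPred_eq, ← hu]
        exact (hP u v).2 hPv
      · simp only [← hu, inv_smul_smul]
    · rintro ⟨⟨x, u⟩, ⟨hx, -⟩, rfl⟩
      exact ⟨(smul_ne_zero_iff_ne u).2 x.rep_nonzero, (hP u _).2 hx⟩
  rw [himage, Set.ncard_image_of_injective _ hinj, Set.ncard_prod, Set.ncard_univ]

theorem eval_f₃ {K : Type*} [CommRing K] (θ : K) (v : Fin 4 → K) :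
    eval v (f₃ K θ) = v 0 ^ 3 + v 1 ^ 3 + v 2 ^ 3 + θ * v 3 ^ 3 := by
  simp [f₃]

/-- The vectors with zero last coordinate and exactly two nonzero coordinates, parametrised by the
position of the zero among the first three coordinates and the two nonzero values. -/
def twoNonzeroVector {K : Type*} [Field K] (p : Fin 3 × Kˣ × Kˣ) : Fin 4 → K :=
  (![![0, p.2.1, p.2.2, 0], ![p.2.1, 0, p.2.2, 0], ![p.2.1, p.2.2, 0, 0]] :
    Fin 3 → Fin 4 → K) p.1

theorem twoNonzeroVector_injective {K : Type*} [Field K] :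
    Function.Injective (twoNonzeroVector (K := K)) := by
  rintro ⟨i, a, b⟩ ⟨j, c, d⟩ h
  have h0 := congrFun h 0
  have h1 := congrFun h 1
  have h2 := congrFun h 2
  fin_cases i <;> fin_cases j <;> simp_all [twoNonzeroVector, Units.ext_iff]

/-- Over a field with four elements, the nonzero zeros of `f₃` are the vectors with `W = 0` and
exactly two of `X, Y, Z` nonzero. -/
theorem setOf_eval_f₃_eq_range {K : Type*} [Field K] (hK : Nat.card K = 4) (θ : K)
    (hθ : θ ^ 2 + θ + 1 = 0) :
    {v : Fin 4 → K | v ≠ 0 ∧ eval v (f₃ K θ) = 0} = Set.range twoNonzeroVector := by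
  have : Finite K := Nat.finite_of_card_ne_zero (by omega)
  have := Fintype.ofFinite K
  have hcube (a : K) (ha : a ≠ 0) : a ^ 3 = 1 := by
    have := FiniteField.pow_card_sub_one_eq_one a ha
    rwa [← Nat.card_eq_fintype_card, hK] at this
  have htwo : (1 + 1 : K) = 0 := by
    have h := FiniteField.cast_card_eq_zero K
    rw [← Nat.card_eq_fintype_card, hK] at h
    have h4 : (1 + 1 : K) * (1 + 1) = 0 := by
      push_cast at h
      linear_combination h
    exact mul_self_eq_zero.1 h4
  have hθ0 : θ ≠ 0 := by rintro rfl; simp at hθ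
  have hθ1 : 1 + θ ≠ 0 := by
    intro h
    exact one_ne_zero (α := K) (by linear_combination hθ - θ * h)
  ext v
  rw [Set.mem_ofPred_eq, eval_f₃]
  constructor
  · rintro ⟨hv, h⟩
    have hv' : ¬ (v 0 = 0 ∧ v 1 = 0 ∧ v 2 = 0 ∧ v 3 = 0) := by
      rintro ⟨h0, h1, h2, h3⟩
      exact hv (by ext i; fin_cases i <;> assumption)
    by_cases h0 : v 0 = 0 <;> by_cases h1 : v 1 = 0 <;> by_cases h2 : v 2 = 0 <;>
      by_cases h3 : v 3 = 0 <;> simp [h0, h1, h2, h3, hcube, htwo, hθ0, hθ1] at h hv'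
    · exact ⟨(0, Units.mk0 _ h1, Units.mk0 _ h2), by
        ext i; fin_cases i <;> simp [twoNonzeroVector, h0, h3]⟩
    · exact ⟨(1, Units.mk0 _ h0, Units.mk0 _ h2), by
        ext i; fin_cases i <;> simp [twoNonzeroVector, h1, h3]⟩
    · exact ⟨(2, Units.mk0 _ h0, Units.mk0 _ h1), by
        ext i; fin_cases i <;> simp [twoNonzeroVector, h2, h3]⟩
  · rintro ⟨⟨i, a, b⟩, rfl⟩
    have ha := hcube a a.ne_zero
    have hb := hcube b b.ne_zero
    constructor
    · intro h
      have h0 := congrFun h 0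
      have h1 := congrFun h 1
      fin_cases i <;> simp [twoNonzeroVector] at h0 h1
    · fin_cases i <;> simp [twoNonzeroVector, ha, hb, htwo]

/-- For each `θ ∈ 𝔽₄` with `θ² + θ + 1 = 0`, the cubic surface `S₃(θ)` has exactly nine
`𝔽₄`-rational points (equivalently, `27` nonzero vectors of `𝔽₄⁴` lie on the affine cone). -/
theorem S₃_card_points_over_F4 (θ : GaloisField 2 2) (hθ : θ ^ 2 + θ + 1 = 0) :
    {x : Projectivization (GaloisField 2 2) (Fin 4 → GaloisField 2 2) |
        eval x.rep (f₃ (GaloisField 2 2) θ) = 0}.ncard = 9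
      ∧ {v : Fin 4 → GaloisField 2 2 | v ≠ 0 ∧ eval v (f₃ (GaloisField 2 2) θ) = 0}.ncard
          = 27 := by
  have hK : Nat.card (GaloisField 2 2) = 4 := GaloisField.card 2 2 two_ne_zero
  have hU : Nat.card (GaloisField 2 2)ˣ = 3 := by rw [Nat.card_units, hK]
  have hcone : {v : Fin 4 → GaloisField 2 2 |
      v ≠ 0 ∧ eval v (f₃ (GaloisField 2 2) θ) = 0}.ncard = 27 := by
    rw [setOf_eval_f₃_eq_range hK θ hθ, ← Set.image_univ,
      Set.ncard_image_of_injective _ twoNonzeroVector_injective, Set.ncard_univ]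
    simp only [Nat.card_prod, hU, Nat.card_fin]
  refine ⟨?_, hcone⟩
  have h := ncard_cone_eq_ncard_projective_mul (K := GaloisField 2 2)
    (fun v => eval v (f₃ (GaloisField 2 2) θ) = 0) fun u v => by
      have hsmul : eval (u • v) (f₃ (GaloisField 2 2) θ) =
          (u : GaloisField 2 2) ^ 3 * eval v (f₃ (GaloisField 2 2) θ) := by
        simp only [eval_f₃, Pi.smul_apply, Units.smul_def, smul_eq_mul]
        ring
      rw [hsmul, mul_eq_zero, or_iff_right (pow_ne_zero 3 u.ne_zero)]
  rw [hcone, hU] at h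
  omega
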